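/- Let N ≥ 2 be an integer and let a, ρ be real numbers with 0 ≤ a < 1 and 0 < ρ < 1. Then Σ_{l=0}^{N−1} Σ_{n=1}^{∞} cos(2πln/N) · ρⁿ/(1 − aⁿ) = Σ_{p=0}^{∞} N · ρ^N a^{Np}/(1 − ρ^N a^{Np}). -/

import Mathlib

/-- Orthogonality of the cosines: `Σ_{l<N} cos(2πlk/N)` is `N` if `N ∣ k` and `0` otherwise. -/
theorem sum_range_cos_two_pi_mul_div {N : ℕ} (hN : N ≠ 0) (k : ℕ) :
    ∑ l ∈ Finset.range N, Real.cos (2 * Real.pi * l * k / N) = if N ∣ k then (N : ℝ) else 0 := by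
  have hζ := Complex.isPrimitiveRoot_exp N hN
  set ζ := Complex.exp (2 * Real.pi * Complex.I / N) with hζ_def
  have hcos (l : ℕ) : Real.cos (2 * Real.pi * l * k / N) = ((ζ ^ k) ^ l).re := by
    rw [← Complex.exp_ofReal_mul_I_re, hζ_def, ← Complex.exp_nat_mul, ← Complex.exp_nat_mul]
    congr 2
    push_cast
    ring
  simp_rw [hcos, ← Complex.re_sum]
  split_ifs with h
  · simp [(hζ.pow_eq_one_iff_dvd k).2 h]
  · have hne : ζ ^ k ≠ 1 := fun h1 => h ((hζ.pow_eq_one_iff_dvd k).1 h1)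
    rw [geom_sum_eq hne, ← pow_mul, mul_comm, pow_mul, hζ.pow_eq_one]
    simp

/-- A sum supported on the positive multiples of `N` is a sum over their quotients by `N`. -/
theorem tsum_ite_dvd_succ {N : ℕ} (hN : N ≠ 0) (f : ℕ → ℝ) :
    ∑' n : ℕ, (if N ∣ n + 1 then f (n + 1) else 0) = ∑' m : ℕ, f (N * (m + 1)) := by
  have hsucc (m : ℕ) : N * (m + 1) - 1 + 1 = N * (m + 1) :=
    Nat.sub_add_cancel (Nat.mul_pos (Nat.pos_of_ne_zero hN) m.succ_pos)
  have hinj : Function.Injective fun m : ℕ => N * (m + 1) - 1 := by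
    intro m m' h
    have h' : N * (m + 1) = N * (m' + 1) := by
      rw [← hsucc m, ← hsucc m']
      exact congrArg (· + 1) h
    exact Nat.succ_injective (Nat.eq_of_mul_eq_mul_left (Nat.pos_of_ne_zero hN) h')
  rw [← hinj.tsum_eq]
  · simp [hsucc]
  · intro n hn
    have hd : N ∣ n + 1 := by
      by_contra h
      simp [h] at hn
    obtain ⟨c, hc⟩ := hd
    obtain ⟨m, rfl⟩ := Nat.exists_eq_succ_of_ne_zero (n := c) (by rintro rfl; simp at hc)
    exact ⟨m, by simp only [Nat.succ_eq_add_one] at hc; simp [← hc]⟩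

/-- The Lambert series identity `Σ_{m≥1} rᵐ/(1 − bᵐ) = Σ_{p≥0} r bᵖ/(1 − r bᵖ)`. -/
theorem tsum_pow_div_one_sub_pow {r b : ℝ} (hr0 : 0 ≤ r) (hr1 : r < 1) (hb0 : 0 ≤ b)
    (hb1 : b < 1) :
    ∑' m : ℕ, r ^ (m + 1) / (1 - b ^ (m + 1)) = ∑' p : ℕ, r * b ^ p / (1 - r * b ^ p) := by
  have hbound : Summable fun x : ℕ × ℕ => r ^ (x.1 + 1) * b ^ x.2 :=
    ((summable_nat_add_iff 1).2 (summable_geometric_of_lt_one hr0 hr1)).mul_of_nonneg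
      (summable_geometric_of_lt_one hb0 hb1) (fun _ => by positivity) (fun _ => by positivity)
  have hsum : Summable fun x : ℕ × ℕ => r ^ (x.1 + 1) * (b ^ (x.1 + 1)) ^ x.2 :=
    hbound.of_nonneg_of_le (fun _ => by positivity) fun x => by
      gcongr
      exact pow_le_of_le_one hb0 hb1.le x.1.succ_ne_zero
  have hrow (m : ℕ) :
      r ^ (m + 1) / (1 - b ^ (m + 1)) = ∑' p : ℕ, r ^ (m + 1) * (b ^ (m + 1)) ^ p := by
    rw [tsum_mul_left, tsum_geometric_of_lt_one (by positivity)
      (pow_lt_one₀ hb0 hb1 m.succ_ne_zero), div_eq_mul_inv]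
  have hcol (p : ℕ) :
      r * b ^ p / (1 - r * b ^ p) = ∑' m : ℕ, r ^ (m + 1) * (b ^ (m + 1)) ^ p := by
    have hlt : r * b ^ p < 1 :=
      (mul_le_of_le_one_right hr0 (pow_le_one₀ hb0 hb1.le)).trans_lt hr1
    rw [div_eq_mul_inv, ← tsum_geometric_of_lt_one (by positivity) hlt, ← tsum_mul_left]
    congr 1 with m
    rw [← pow_succ', mul_pow, pow_right_comm]
  simp_rw [hrow, hcol]
  exact hsum.prod_symm.tsum_comm

/-- The weighted cosine series `Σ_{n≥1} cos(θ n) ρⁿ/(1 − aⁿ)` converges absolutely. -/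
theorem summable_cos_mul_pow_div_one_sub_pow {a ρ : ℝ} (ha0 : 0 ≤ a) (ha1 : a < 1) (hρ0 : 0 ≤ ρ)
    (hρ1 : ρ < 1) (θ : ℕ → ℝ) :
    Summable fun n : ℕ => Real.cos (θ n) * ρ ^ (n + 1) / (1 - a ^ (n + 1)) := by
  have hgeom : Summable fun n : ℕ => ρ ^ (n + 1) / (1 - a) :=
    ((summable_nat_add_iff 1).2 (summable_geometric_of_lt_one hρ0 hρ1)).div_const _
  refine hgeom.of_norm_bounded fun n => ?_
  have hpow : a ^ (n + 1) ≤ a := pow_le_of_le_one ha0 ha1.le n.succ_ne_zero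
  rw [Real.norm_eq_abs, abs_div, abs_mul, abs_of_nonneg (pow_nonneg hρ0 _),
    abs_of_pos (show 0 < 1 - a ^ (n + 1) by linarith)]
  have h1a : 0 < 1 - a := by linarith
  gcongr
  exact mul_le_of_le_one_left (by positivity) (Real.abs_cos_le_one _)

/-- For `N ≥ 2`, `0 ≤ a < 1` and `0 < ρ < 1`,
`Σ_{l=0}^{N−1} Σ_{n=1}^{∞} cos(2πln/N) · ρⁿ/(1 − aⁿ)
  = Σ_{p=0}^{∞} N·ρ^N a^{Np}/(1 − ρ^N a^{Np})`. -/
theorem resummation_Q_plus_P (N : ℕ) (hN : 2 ≤ N)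
    (a ρ : ℝ) (ha0 : 0 ≤ a) (ha1 : a < 1) (hρ0 : 0 < ρ) (hρ1 : ρ < 1) :
    ∑ l ∈ Finset.range N, ∑' n : ℕ,
        Real.cos (2 * Real.pi * l * (n + 1) / N) * ρ ^ (n + 1) / (1 - a ^ (n + 1))
      = ∑' p : ℕ, (N : ℝ) * ρ ^ N * a ^ (N * p) / (1 - ρ ^ N * a ^ (N * p)) := by
  have hN0 : N ≠ 0 := by omega
  rw [← Summable.tsum_finsetSum fun l _ =>
    summable_cos_mul_pow_div_one_sub_pow ha0 ha1 hρ0.le hρ1 _]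
  have hcos (n : ℕ) : ∑ l ∈ Finset.range N,
      Real.cos (2 * Real.pi * l * (n + 1) / N) * ρ ^ (n + 1) / (1 - a ^ (n + 1)) =
      if N ∣ n + 1 then (N : ℝ) * (ρ ^ (n + 1) / (1 - a ^ (n + 1))) else 0 := by
    have h := sum_range_cos_two_pi_mul_div hN0 (n + 1)
    push_cast at h
    rw [← Finset.sum_div, ← Finset.sum_mul, h]
    split_ifs <;> ring
  simp_rw [hcos]
  rw [tsum_ite_dvd_succ hN0 fun k => (N : ℝ) * (ρ ^ k / (1 - a ^ k)), tsum_mul_left]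
  simp_rw [pow_mul, mul_assoc, mul_div_assoc (N : ℝ)]
  rw [tsum_mul_left, tsum_pow_div_one_sub_pow (by positivity) (pow_lt_one₀ hρ0.le hρ1 hN0)
    (by positivity) (pow_lt_one₀ ha0 ha1 hN0)]
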